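/- arXiv:1409.2459 — 3 statements merged into one kernel-verified Lean document; each statement's English description precedes it below -/
import Mathlib

section
/- Let F be a finite field of order q = 3^n with n odd and r a positive integer with gcd(r, n) = 1 and gcd(3^r + 2, q − 1) = 1. Then the set K = {(x, y) ∈ F² : x^{3^{2r}}·y^{3^r} + x^{3^r}·y^{3^{2r}} + x·y = 0} has exactly 3q elements. -/
open Finset in
lemma aux_pow_sum {G : Type*} [CommGroup G] [Fintype G] (m h : ℕ) (hG : Nat.card G = 2 * h)
    (hh : Odd h) (hm : Nat.gcd m (2 * h) = 2) (f : G → ℤ) :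
    ∑ u : G, f (u ^ m) = ∑ u : G, f (u ^ 2) := by
  have key : ∃ k, Nat.Coprime (2 * h) k ∧ ∀ u : G, u ^ m = (u ^ k) ^ 2 := by
    obtain ⟨k, rfl⟩ : 2 ∣ m := hm ▸ Nat.gcd_dvd_left m (2 * h)
    have hk : Nat.gcd k h = 1 := by
      rw [Nat.gcd_mul_left] at hm; omega
    have hkh : Nat.Coprime h k := (Nat.coprime_comm).1 hk
    rcases Nat.even_or_odd k with he | ho
    · refine ⟨k + h, ?_, ?_⟩
      · refine Nat.Coprime.mul_left ?_ ?_
        · rw [Nat.coprime_two_left]; exact he.add_odd hh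
        · simpa using hkh
      · intro u
        have : u ^ (2 * h) = 1 := by rw [← hG]; exact pow_card_eq_one'
        rw [← pow_mul, add_mul, pow_add, mul_comm h 2, this, mul_one, mul_comm]
    · refine ⟨k, ?_, ?_⟩
      · exact Nat.Coprime.mul_left (by rwa [Nat.coprime_two_left]) hkh
      · intro u; rw [← pow_mul, mul_comm]
  obtain ⟨k, hk, hu⟩ := key
  rw [← hG] at hk
  rw [← (powCoprime hk).sum_comp (fun u => f (u ^ 2))]
  refine Finset.sum_congr rfl fun u _ => ?_
  rw [hu]; rfl

lemma aux_sum_units {F : Type*} [Field F] [Fintype F] [DecidableEq F] (f : F → ℤ) :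
    ∑ x : F, f x = f 0 + ∑ u : Fˣ, f u := by
  classical
  rw [← Finset.add_sum_erase _ _ (Finset.mem_univ (0 : F))]
  congr 1
  symm
  refine Finset.sum_bij (fun u _ => (u : F)) ?_ ?_ ?_ ?_
  · intro u _; simp
  · intro a _ b _ h; exact Units.ext h
  · intro b hb; exact ⟨Units.mk0 b (by simpa using hb), Finset.mem_univ _, rfl⟩
  · intros; rfl

lemma aux_sqrts {F : Type*} [Field F] [Fintype F] [DecidableEq F] (hF : ringChar F ≠ 2) (a : F) :
    ∑ x : F, (if x ^ 2 = a then (1 : ℤ) else 0) = quadraticChar F a + 1 := by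
  rw [← quadraticChar_card_sqrts hF a, Finset.sum_boole]
  congr 2
  ext; simp

lemma aux_char {F : Type*} [Field F] [Fintype F] [DecidableEq F] (hF : ringChar F ≠ 2)
    (h1 : quadraticChar F (-1) = -1) :
    ∑ x : F, quadraticChar F (1 + x ^ 2) = -1 := by
  have e1 : ∀ x : F, quadraticChar F (1 + x ^ 2) =
      ∑ u : F, (if x ^ 2 = u then (1 : ℤ) else 0) * quadraticChar F (1 + u) := by
    intro x; simp
  simp_rw [e1]
  rw [Finset.sum_comm]
  simp_rw [← Finset.sum_mul, aux_sqrts hF, add_mul, one_mul]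
  rw [Finset.sum_add_distrib]
  have e2 : ∑ u : F, quadraticChar F (1 + u) = 0 := by
    rw [← quadraticChar_sum_zero hF]
    exact Equiv.sum_comp (Equiv.addLeft (1 : F)) (fun u => quadraticChar F u)
  have e3 := jacobiSum_nontrivial_inv (quadraticChar_ne_one hF)
  rw [(quadraticChar_isQuadratic F).inv, h1, jacobiSum, ← Equiv.sum_comp (Equiv.neg F)] at e3
  have e4 : ∑ u : F, quadraticChar F u * quadraticChar F (1 + u) = -1 := by
    have : ∀ u : F, quadraticChar F (Equiv.neg F u) * quadraticChar F (1 - Equiv.neg F u)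
        = - (quadraticChar F u * quadraticChar F (1 + u)) := by
      intro u
      rw [Equiv.neg_apply, neg_eq_neg_one_mul, map_mul, h1]
      simp
    simp_rw [this, Finset.sum_neg_distrib] at e3
    omega
  rw [e2, e4]; rfl

theorem stmt_7 (F : Type*) [Field F] [Fintype F] (n r : ℕ) (hn : Odd n)
    (hcard : Fintype.card F = 3 ^ n) (hr : 0 < r) (hgcd : Nat.gcd r n = 1)
    (hd : Nat.gcd (3 ^ r + 2) (3 ^ n - 1) = 1) :
    {xy : F × F | xy.1 ^ (3 ^ (2 * r)) * xy.2 ^ (3 ^ r)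
        + xy.1 ^ (3 ^ r) * xy.2 ^ (3 ^ (2 * r)) + xy.1 * xy.2 = 0}.ncard
      = 3 * 3 ^ n := by
  classical
  -- characteristic three
  have hchar : CharP F 3 := by
    obtain ⟨p, hp⟩ := CharP.exists F
    obtain ⟨k, hpp, hk⟩ := FiniteField.card F p
    have : p ∣ 3 ^ n := by
      rw [← hcard, hk]; exact dvd_pow_self p k.pos.ne'
    have := (Nat.prime_dvd_prime_iff_eq hpp Nat.prime_three).1 (hpp.dvd_of_dvd_pow this)
    exact this ▸ hp
  have : Fact (Nat.Prime 3) := ⟨Nat.prime_three⟩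
  have hF : ringChar F ≠ 2 := by rw [ringChar.eq F 3]; norm_num
  have hmod : 3 ^ n % 4 = 3 := by
    obtain ⟨k, rfl⟩ := hn
    rw [pow_succ, pow_mul, Nat.mul_mod, Nat.pow_mod]; norm_num
  have h1 : quadraticChar F (-1) = -1 := by
    rw [quadraticChar_neg_one hF, hcard, ZMod.χ₄_nat_eq_if_mod_four, hmod]
    simp; omega
  obtain ⟨h, hh, hN⟩ : ∃ h, Odd h ∧ 3 ^ n - 1 = 2 * h :=
    ⟨(3 ^ n - 1) / 2, by rw [Nat.odd_iff]; omega, by omega⟩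
  have hG : Nat.card Fˣ = 2 * h := by
    rw [Nat.card_units, Nat.card_eq_fintype_card, hcard, hN]
  have hg2 : Nat.gcd (3 ^ r - 1) (2 * h) = 2 := by
    rw [← hN, Nat.pow_sub_one_gcd_pow_sub_one, hgcd]; norm_num
  have hgm : Nat.gcd ((3 ^ r + 2) * (3 ^ r - 1)) (2 * h) = 2 := by
    rw [hN] at hd
    rw [Nat.Coprime.gcd_mul_left_cancel _ hd, hg2]
  obtain ⟨e, he⟩ : ∃ e, 3 ^ r = e + 1 := ⟨3 ^ r - 1, by have := Nat.one_le_pow r 3 (by norm_num); omega⟩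
  have hQodd : Odd (3 ^ r) := Odd.pow (by decide)
  have hadd : ∀ a b : F, (a + b) ^ 3 ^ r = a ^ 3 ^ r + b ^ 3 ^ r := fun a b => add_pow_char_pow a b ..
  have hsq : ∀ a : F, a ^ 3 ^ (2 * r) = (a ^ 3 ^ r) ^ 3 ^ r := fun a => by
    rw [two_mul, pow_add, pow_mul]
  have hηQ : ∀ a : F, quadraticChar F (a ^ 3 ^ r) = quadraticChar F a := by
    intro a
    obtain ⟨k, hk⟩ := hQodd
    by_cases ha : a = 0
    · subst ha; simp
    · rw [hk, pow_succ, pow_mul, map_mul, map_pow, map_pow, quadraticChar_sq_one ha]; simp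
  -- nonvanishing
  have hne : ∀ z : F, z ≠ 0 → 1 + z ^ e ≠ 0 := by
    intro z hz h0
    have hee : Even e := by
      rw [he] at hQodd; rcases Nat.even_or_odd e with h | h
      · exact h
      · exact absurd hQodd (by simpa using h.add_one)
    obtain ⟨k, hk⟩ := hee
    have h2 : (-1 : F) = z ^ k * z ^ k := by
      rw [← pow_add, ← hk]; linear_combination -h0
    have h3 : quadraticChar F (-1) = 1 := by
      rw [h2, ← pow_two, map_pow, quadraticChar_sq_one (pow_ne_zero _ hz)]
    rw [h1] at h3; norm_num at h3
  -- the inner count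
  have inner : ∀ z : Fˣ, ∑ x : Fˣ, (if ((x : F) ^ 3 ^ r) ^ 3 ^ r * (x : F) ^ 3 ^ r *
      ((z : F) ^ 3 ^ r + ((z : F) ^ 3 ^ r) ^ 3 ^ r) + (x : F) * (x * z) = 0 then (1 : ℤ) else 0)
      = 1 - quadraticChar F (1 + (z ^ e : Fˣ)) := by
    intro z
    have hz : (z : F) ≠ 0 := z.ne_zero
    set w : F := (z : F) * (1 + (z : F) ^ e) with hw
    have hw0 : w ≠ 0 := mul_ne_zero hz (hne _ hz)
    have hwQ : (z : F) ^ 3 ^ r + ((z : F) ^ 3 ^ r) ^ 3 ^ r = w ^ 3 ^ r := by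
      rw [← hadd, hw]; congr 1; rw [he]; ring
    set c : F := - z / w ^ 3 ^ r with hc
    have hc0 : c ≠ 0 := div_ne_zero (neg_ne_zero.2 hz) (pow_ne_zero _ hw0)
    have hiff : ∀ x : Fˣ, (((x : F) ^ 3 ^ r) ^ 3 ^ r * (x : F) ^ 3 ^ r *
      ((z : F) ^ 3 ^ r + ((z : F) ^ 3 ^ r) ^ 3 ^ r) + (x : F) * (x * z) = 0) ↔
        ((x ^ ((3 ^ r + 2) * (3 ^ r - 1)) : Fˣ) : F) = c := by
      intro x
      have hx : (x : F) ≠ 0 := x.ne_zero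
      have hxx : ((x : F) ^ 3 ^ r) ^ 3 ^ r * (x : F) ^ 3 ^ r =
          x ^ 2 * (x : F) ^ ((3 ^ r + 2) * (3 ^ r - 1)) := by
        rw [he, ← pow_mul, ← pow_add, ← pow_add]; congr 1
        simp only [Nat.add_sub_cancel]; ring
      rw [hwQ, hxx, hc, eq_div_iff (pow_ne_zero _ hw0), Units.val_pow_eq_pow_val]
      constructor
      · intro h
        have : (x : F) ^ 2 * (x ^ ((3 ^ r + 2) * (3 ^ r - 1)) * w ^ 3 ^ r + z) = 0 := by
          linear_combination h
        have := (mul_eq_zero.1 this).resolve_left (pow_ne_zero _ hx)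
        linear_combination this
      · intro h
        linear_combination (x : F) ^ 2 * h
    simp_rw [hiff]
    rw [aux_pow_sum _ h hG hh hgm (fun u : Fˣ => if (u : F) = c then (1 : ℤ) else 0)]
    have h5 := aux_sqrts hF c
    rw [aux_sum_units] at h5
    rw [if_neg (by rw [zero_pow two_ne_zero]; exact hc0.symm), zero_add] at h5
    simp only [Units.val_pow_eq_pow_val]
    rw [h5]
    have : quadraticChar F c = - quadraticChar F (1 + (z : F) ^ e) := by
      have h6 : c * w ^ 3 ^ r = -1 * z := by
        rw [hc, div_mul_cancel₀ _ (pow_ne_zero _ hw0)]; ring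
      have h7 := congrArg (quadraticChar F) h6
      rw [map_mul, hηQ, map_mul (quadraticChar F) (-1), h1, hw, map_mul] at h7
      have h8 := quadraticChar_sq_one hz
      have h9 := quadraticChar_sq_one (hne _ hz)
      linear_combination (quadraticChar F z * quadraticChar F (1 + (z : F) ^ e)) * h7
        - (quadraticChar F c * quadraticChar F (1 + (z : F) ^ e) ^ 2
           + quadraticChar F (1 + (z : F) ^ e)) * h8 - quadraticChar F c * h9
    rw [this]; ring
  have outer : ∑ z : Fˣ, quadraticChar F (1 + (z ^ e : Fˣ)) = -2 := by
    have he' : 3 ^ r - 1 = e := by omega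
    rw [he'] at hg2
    rw [aux_pow_sum _ h hG hh hg2 (fun u : Fˣ => quadraticChar F (1 + (u : F)))]
    have := aux_char hF h1
    rw [aux_sum_units] at this
    simp only [Units.val_pow_eq_pow_val]
    rw [zero_pow two_ne_zero, add_zero, map_one] at this
    linarith
  have hcu : (Fintype.card Fˣ : ℤ) = 3 ^ n - 1 := by
    rw [Fintype.card_units, hcard, Nat.cast_sub (Nat.one_le_pow _ _ (by norm_num))]; simp
  have h0Q : (3 : ℕ) ^ r ≠ 0 := by positivity
  zify
  rw [Set.ncard_eq_toFinset_card', Set.toFinset_ofPred, ← Finset.sum_boole, Fintype.sum_prod_type,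
    aux_sum_units]
  simp_rw [hsq]
  have step : ∀ x : Fˣ, (∑ y : F, if ((x : F) ^ 3 ^ r) ^ 3 ^ r * y ^ 3 ^ r
      + (x : F) ^ 3 ^ r * (y ^ 3 ^ r) ^ 3 ^ r + x * y = 0 then (1 : ℤ) else 0)
      = 1 + ∑ z : Fˣ, (if ((x : F) ^ 3 ^ r) ^ 3 ^ r * (x : F) ^ 3 ^ r *
      ((z : F) ^ 3 ^ r + ((z : F) ^ 3 ^ r) ^ 3 ^ r) + (x : F) * (x * z) = 0 then (1 : ℤ) else 0) := by
    intro x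
    rw [aux_sum_units, ← Equiv.sum_comp (Equiv.mulLeft x)]
    congr 1
    · simp
    · refine Finset.sum_congr rfl fun z _ => ?_
      congr 1
      simp only [Equiv.coe_mulLeft, Units.val_mul, mul_pow]
      congr 1
      ring
  simp_rw [step]
  rw [Finset.sum_add_distrib, Finset.sum_comm]
  simp_rw [inner]
  rw [Finset.sum_sub_distrib, outer]
  simp [hcu, hcard]
  ring
end

section
/- Let F be a finite field of order q = 3^n with n odd, and d = 3^r + 2 with gcd(d, q − 1) = gcd(r, n) = 1. Then ∑_{a ∈ F, a ≠ 0} W(a)⁴ = 3q³, where W(a) = ∑_{x ∈ F} ψ(x^d − a·x) and ψ is the canonical additive character of F. -/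
/-- The canonical additive character of a finite field `F` of characteristic `p`:
`ψ(x) = exp(2πi·Tr(x)/p)`, where `Tr` is the absolute trace. -/
noncomputable def canonicalPsi (p : ℕ) (F : Type*) [Field F] [Fintype F]
    [Algebra (ZMod p) F] (x : F) : ℂ :=
  Complex.exp (2 * Real.pi * Complex.I * ((Algebra.trace (ZMod p) F x).val : ℂ) / p)

theorem aux_char_s9 (F : Type*) [Field F] [Fintype F] [Algebra (ZMod 3) F] :
    ∃ ψ : AddChar F ℂ, ψ.IsPrimitive ∧ ∀ x, canonicalPsi 3 F x = ψ x := by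
  refine ⟨(ZMod.stdAddChar (N := 3)).compAddMonoidHom
    (Algebra.trace (ZMod 3) F).toAddMonoidHom, ?_, ?_⟩
  · apply AddChar.IsPrimitive.of_ne_one
    have : Fact (Nat.Prime 3) := ⟨Nat.prime_three⟩
    obtain ⟨a, ha⟩ := Algebra.trace_surjective (ZMod 3) F 1
    refine AddChar.ne_one_iff.2 ⟨a, ?_⟩
    simp only [AddChar.coe_compAddMonoidHom, Function.comp_apply, LinearMap.toAddMonoidHom_coe, ha]
    intro h
    rw [← (ZMod.stdAddChar (N := 3)).map_zero_eq_one, ZMod.injective_stdAddChar.eq_iff] at h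
    exact one_ne_zero h
  · intro x
    simp only [AddChar.coe_compAddMonoidHom, Function.comp_apply, LinearMap.toAddMonoidHom_coe]
    rw [ZMod.stdAddChar_apply, ZMod.toCircle_apply]
    rfl

theorem aux_pow_bij (F : Type*) [Field F] [Fintype F] (k : ℕ) (hk0 : k ≠ 0)
    (hk : Nat.Coprime k (Fintype.card F - 1)) : Function.Bijective (fun x : F => x ^ k) := by
  classical
  rw [← Finite.injective_iff_bijective]
  intro x y h
  simp only at h
  by_cases hx : x = 0
  · subst hx
    rw [zero_pow hk0] at h
    exact (eq_zero_of_pow_eq_zero h.symm).symm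
  by_cases hy : y = 0
  · subst hy
    rw [zero_pow hk0] at h
    exact eq_zero_of_pow_eq_zero h
  have hb : Function.Bijective (fun u : Fˣ => u ^ k) :=
    Nat.Coprime.pow_left_bijective (by
      rw [Nat.card_eq_fintype_card, Fintype.card_units]; exact hk.symm)
  have := @hb.1 (Units.mk0 x hx) (Units.mk0 y hy) (by ext; simpa using h)
  simpa using congrArg Units.val this

theorem aux_exp (n r : ℕ) (hn : Odd n) (hrn : Nat.gcd r n = 1) :
    ∃ k e : ℕ, Nat.Coprime k (3 ^ n - 1) ∧ k ≠ 0 ∧ 2 * k + 1 = 3 ^ r + e * (3 ^ n - 1) := by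
  have hg := Nat.pow_sub_one_gcd_pow_sub_one 3 r n
  rw [hrn] at hg
  have h4 : 3 ^ n % 4 = 3 := by
    obtain ⟨m, rfl⟩ := hn
    rw [pow_succ, pow_mul, Nat.mul_mod, Nat.pow_mod]; norm_num
  have h2 : 3 ^ r % 2 = 1 := by rw [Nat.pow_mod]; norm_num
  obtain ⟨m, hm⟩ : ∃ m, 3 ^ r = 2 * m + 1 := ⟨3 ^ r / 2, by omega⟩
  obtain ⟨l, hl⟩ : ∃ l, 3 ^ n = 2 * l + 1 := ⟨3 ^ n / 2, by omega⟩
  have hlo : l % 2 = 1 := by omega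
  rw [hm, hl] at hg
  simp only [Nat.add_sub_cancel, pow_one] at hg
  rw [Nat.gcd_mul_left] at hg
  have hml : Nat.Coprime m l := by unfold Nat.Coprime; omega
  rw [hl, hm]
  simp only [Nat.add_sub_cancel]
  rcases Nat.even_or_odd m with he | ho
  · refine ⟨m + l, 1, ?_, by omega, by ring⟩
    apply Nat.Coprime.mul_right
    · rw [Nat.coprime_two_right]
      exact he.add_odd (Nat.odd_iff.2 hlo)
    · simpa using hml
  · refine ⟨m, 0, ?_, ?_, by ring⟩
    · exact Nat.Coprime.mul_right (by rwa [Nat.coprime_two_right]) hml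
    · rintro rfl; simp at ho

theorem aux_conic (F : Type*) [Field F] [Fintype F] [DecidableEq F]
    (hq : Fintype.card F % 4 = 3) :
    (Finset.univ.filter (fun p : F × F => p.1 ^ 2 + p.2 ^ 2 = -1)).card = Fintype.card F + 1 := by
  set N : F → ℕ := fun c => (Finset.univ.filter (fun p : F × F => p.1 ^ 2 + p.2 ^ 2 = c)).card
    with hN
  have hle : ∀ c e : F, e ≠ 0 → N c ≤ N (c * e) := by
    intro c e he
    obtain ⟨s, t, hst⟩ : ∃ s t : F, s ^ 2 + t ^ 2 = e := by
      obtain ⟨a, b, hab⟩ := FiniteField.exists_root_sum_quadratic (R := F)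
        (f := Polynomial.X ^ 2) (g := Polynomial.X ^ 2 - Polynomial.C e)
        (by simp) (Polynomial.degree_X_pow_sub_C (by norm_num) _) (by omega)
      refine ⟨a, b, ?_⟩
      simp at hab
      linear_combination hab
    apply Finset.card_le_card_of_injOn
      (fun p : F × F => (p.1 * s - p.2 * t, p.1 * t + p.2 * s))
    · intro p hp
      simp only [Finset.coe_filter, Finset.mem_univ, true_and, Set.mem_ofPred_eq] at hp ⊢
      rw [← hst, ← hp]; ring
    · rintro ⟨a, b⟩ - ⟨a', b'⟩ - h
      simp only [Prod.mk.injEq] at h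
      obtain ⟨h1, h2⟩ := h
      have e1 : (a - a') * e = 0 := by rw [← hst]; linear_combination s * h1 + t * h2
      have e2 : (b - b') * e = 0 := by rw [← hst]; linear_combination s * h2 - t * h1
      simp only [mul_eq_zero, he, or_false, sub_eq_zero] at e1 e2
      simp [e1, e2]
  have heq : ∀ c : F, c ≠ 0 → N c = N (-1) := by
    intro c hc
    apply le_antisymm
    · have := hle c (-c⁻¹) (by simpa using hc)
      rwa [mul_neg, mul_inv_cancel₀ hc] at this
    · have := hle (-1) (-c) (by simpa using hc)
      simpa using this
  have h0 : N 0 = 1 := by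
    rw [hN]
    simp only
    rw [Finset.card_eq_one]
    refine ⟨(0, 0), ?_⟩
    ext ⟨a, b⟩
    simp only [Finset.mem_filter, Finset.mem_univ, true_and, Finset.mem_singleton, Prod.mk.injEq]
    constructor
    · intro h
      have hb : b = 0 := by
        by_contra hb
        have : IsSquare (-1 : F) := ⟨a / b, by field_simp; linear_combination -h⟩
        rw [FiniteField.isSquare_neg_one_iff] at this
        exact this hq
      subst hb
      simpa using h
    · rintro ⟨rfl, rfl⟩; simp
  have htot : Fintype.card F ^ 2 = ∑ c : F, N c := by
    have := Finset.card_eq_sum_card_fiberwise (s := (Finset.univ : Finset (F × F)))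
      (t := (Finset.univ : Finset F)) (f := fun p => p.1 ^ 2 + p.2 ^ 2) (by simp)
    rw [Finset.card_univ, Fintype.card_prod] at this
    rw [sq, this]
  rw [← Finset.add_sum_erase _ _ (Finset.mem_univ (0 : F)), h0,
    Finset.sum_congr rfl (fun c hc => heq c (Finset.ne_of_mem_erase hc)), Finset.sum_const,
    Finset.card_erase_of_mem (Finset.mem_univ _), Finset.card_univ, smul_eq_mul] at htot
  change N (-1) = _
  obtain ⟨m, hm⟩ : ∃ m, Fintype.card F = m + 2 := ⟨Fintype.card F - 2, by omega⟩
  rw [hm] at htot ⊢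
  simp only [show m + 2 - 1 = m + 1 by omega] at htot
  have : (m + 1) * N (-1) = (m + 1) * (m + 2 + 1) := by nlinarith
  exact Nat.eq_of_mul_eq_mul_left (by omega) this

theorem aux_count1 (F : Type*) [Field F] [Fintype F] [DecidableEq F]
    (hq : Fintype.card F % 4 = 3) :
    (Finset.univ.filter (fun p : F × F => p.1 * p.2 * (1 + p.1 ^ 2 + p.2 ^ 2) = 0)).card
      = 3 * Fintype.card F := by
  have hns : ∀ a : F, a ^ 2 ≠ -1 := by
    intro a ha
    have : IsSquare (-1 : F) := ⟨a, by rw [← ha, sq]⟩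
    rw [FiniteField.isSquare_neg_one_iff] at this
    exact this hq
  have hsplit : (Finset.univ.filter (fun p : F × F => p.1 * p.2 * (1 + p.1 ^ 2 + p.2 ^ 2) = 0))
      = (({0} : Finset F) ×ˢ Finset.univ ∪ (Finset.univ.erase 0) ×ˢ {0}) ∪
        (Finset.univ.filter (fun p : F × F => p.1 ^ 2 + p.2 ^ 2 = -1)) := by
    ext ⟨a, b⟩
    simp only [Finset.mem_filter, Finset.mem_univ, true_and, Finset.mem_union, Finset.mem_product,
      Finset.mem_singleton, Finset.mem_erase, mul_eq_zero, and_true]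
    have : 1 + a ^ 2 + b ^ 2 = 0 ↔ a ^ 2 + b ^ 2 = -1 := by
      constructor <;> intro h <;> linear_combination h
    rw [this]
    tauto
  rw [hsplit, Finset.card_union_of_disjoint, Finset.card_union_of_disjoint, aux_conic F hq]
  · have : 0 < Fintype.card F := Fintype.card_pos
    simp only [Finset.card_product, Finset.card_singleton, Finset.card_univ,
      Finset.card_erase_of_mem (Finset.mem_univ _)]
    omega
  · rw [Finset.disjoint_left]
    rintro ⟨a, b⟩
    simp
    tauto
  · rw [Finset.disjoint_left]
    rintro ⟨a, b⟩ h h'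
    simp only [Finset.mem_filter, Finset.mem_univ, true_and, Finset.mem_union, Finset.mem_product,
      Finset.mem_singleton, Finset.mem_erase, and_true] at h h'
    rcases h with rfl | ⟨-, rfl⟩
    · exact hns b (by simpa using h')
    · exact hns a (by simpa using h')

theorem aux_count2 (F : Type*) [Field F] [Fintype F] [DecidableEq F]
    (n r : ℕ) (hn : Odd n) (hcard : Fintype.card F = 3 ^ n) (hrn : Nat.gcd r n = 1) :
    (Finset.univ.filter (fun p : F × F =>
      p.1 * p.2 + p.1 * p.2 ^ 3 ^ r + p.2 * p.1 ^ 3 ^ r = 0)).card = 3 * Fintype.card F := by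
  have h4 : 3 ^ n % 4 = 3 := by
    obtain ⟨m, rfl⟩ := hn
    rw [pow_succ, pow_mul, Nat.mul_mod, Nat.pow_mod]; norm_num
  obtain ⟨k, e, hk, hk0, hke⟩ := aux_exp n r hn hrn
  have hbij := aux_pow_bij F k hk0 (by rwa [hcard])
  have hσ : ∀ a : F, a ^ 3 ^ r = a * (a ^ k) ^ 2 := by
    intro a
    by_cases ha : a = 0
    · subst ha; simp
    · have h1 : a ^ (3 ^ n - 1) = 1 := by
        rw [← hcard]; exact FiniteField.pow_card_sub_one_eq_one a ha
      calc a ^ 3 ^ r = a ^ (3 ^ r + e * (3 ^ n - 1)) := by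
            rw [pow_add, mul_comm e, pow_mul, h1]; simp
        _ = _ := by rw [← hke]; ring
  rw [← aux_count1 F (by rw [hcard, h4])]
  refine Finset.card_equiv ((Equiv.ofBijective _ hbij).prodCongr (Equiv.ofBijective _ hbij)) ?_
  rintro ⟨a, b⟩
  simp only [Finset.mem_filter, Finset.mem_univ, true_and, Equiv.prodCongr_apply, Prod.map,
    Equiv.ofBijective_apply]
  rw [hσ, hσ, show a * b + a * (b * (b ^ k) ^ 2) + b * (a * (a ^ k) ^ 2)
    = a * b * (1 + (a ^ k) ^ 2 + (b ^ k) ^ 2) by ring]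
  simp only [mul_eq_zero, pow_eq_zero_iff hk0]

theorem aux_count3 (F : Type*) [Field F] [Fintype F] [DecidableEq F] [CharP F 3]
    (n r : ℕ) (hn : Odd n) (hcard : Fintype.card F = 3 ^ n) (hrn : Nat.gcd r n = 1) :
    (Finset.univ.filter (fun p : F × F =>
      ((p.1 + 1) ^ (3 ^ r + 2) - p.1 ^ (3 ^ r + 2)) - ((p.2 + 1) ^ (3 ^ r + 2) - p.2 ^ (3 ^ r + 2))
        = 0)).card = 3 * Fintype.card F := by
  rw [← aux_count2 F n r hn hcard hrn]
  have : Fact (Nat.Prime 3) := ⟨Nat.prime_three⟩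
  have h3 : (3 : F) = 0 := by exact_mod_cast CharP.cast_eq_zero F 3
  symm
  refine Finset.card_equiv
    { toFun := fun p => (p.1 + p.2 + 1, p.1 - p.2 + 1)
      invFun := fun p => (- p.1 - p.2 - 1, p.2 - p.1)
      left_inv := ?_
      right_inv := ?_ } ?_
  · rintro ⟨a, b⟩
    simp only [Prod.mk.injEq]
    constructor
    · linear_combination (-a - 1) * h3
    · linear_combination (-b) * h3
  · rintro ⟨a, b⟩
    simp only [Prod.mk.injEq]
    constructor
    · linear_combination (-a) * h3
    · linear_combination (-b) * h3
  · rintro ⟨a, b⟩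
    simp only [Finset.mem_filter, Finset.mem_univ, true_and, Equiv.coe_fn_mk]
    simp only [pow_add, add_pow_char_pow, sub_pow_char_pow, one_pow]
    generalize a ^ 3 ^ r = A
    generalize b ^ 3 ^ r = B
    apply Eq.congr_left
    linear_combination (-(a * b + a * B + b * A + 2 * B + 4 * b)) * h3

theorem aux_moment (F : Type*) [Field F] [Fintype F] [DecidableEq F] (ψ : AddChar F ℂ)
    (hψ : ψ.IsPrimitive) (d : ℕ) (hd : Odd d)
    (hb : Function.Bijective (fun x : F => x ^ d)) :
    ∑ a : F, (∑ x : F, ψ (x ^ d - a * x)) ^ 4 = (Fintype.card F : ℂ) ^ 2 *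
      ((Finset.univ.filter (fun p : F × F =>
        ((p.1 + 1) ^ d - p.1 ^ d) - ((p.2 + 1) ^ d - p.2 ^ d) = 0)).card : ℂ) := by
  have hneg : ∀ a : F, ∑ x : F, ψ (x ^ d - a * x) = ∑ x : F, ψ (-(x ^ d - a * x)) := by
    intro a
    refine Fintype.sum_equiv (Equiv.neg F) _ _ ?_
    intro x
    simp only [Equiv.neg_apply, hd.neg_pow]
    congr 1; ring
  have hP : ∀ a : F, (∑ x : F, ψ (x ^ d - a * x)) ^ 2 =
      ∑ u : F, ψ (-(a * u)) * ∑ x : F, ψ ((x + u) ^ d - x ^ d) := by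
    intro a
    rw [sq]
    nth_rewrite 1 [hneg a]
    rw [Finset.sum_mul_sum]
    simp_rw [Finset.mul_sum]
    rw [Finset.sum_comm (s := (Finset.univ : Finset F)) (t := Finset.univ)
      (f := fun u x => ψ (-(a * u)) * ψ ((x + u) ^ d - x ^ d))]
    refine Finset.sum_congr rfl fun x _ => ?_
    refine (Fintype.sum_equiv (Equiv.addLeft x) _ _ ?_).symm
    intro u
    simp only [Equiv.coe_addLeft, ← AddChar.map_add_eq_mul]
    congr 1; ring
  have hP' : ∀ a : F, (∑ x : F, ψ (x ^ d - a * x)) ^ 2 =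
      ∑ u : F, ψ (a * u) * ∑ x : F, ψ (-((x + u) ^ d - x ^ d)) := by
    intro a
    rw [sq]
    nth_rewrite 2 [hneg a]
    rw [Finset.sum_mul_sum]
    simp_rw [Finset.mul_sum]
    rw [Finset.sum_comm (s := (Finset.univ : Finset F)) (t := Finset.univ)
      (f := fun u x => ψ (a * u) * ψ (-((x + u) ^ d - x ^ d)))]
    refine Finset.sum_congr rfl fun x _ => ?_
    refine (Fintype.sum_equiv (Equiv.addLeft x) _ _ ?_).symm
    intro u
    simp only [Equiv.coe_addLeft, ← AddChar.map_add_eq_mul]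
    congr 1; ring
  set A : F → ℂ := fun u => ∑ x : F, ψ ((x + u) ^ d - x ^ d) with hA
  set A' : F → ℂ := fun u => ∑ x : F, ψ (-((x + u) ^ d - x ^ d)) with hA'
  have h1 : ∑ a : F, (∑ x : F, ψ (x ^ d - a * x)) ^ 4 =
      (Fintype.card F : ℂ) * ∑ u : F, A u * A' u := by
    calc ∑ a : F, (∑ x : F, ψ (x ^ d - a * x)) ^ 4
        = ∑ a : F, ∑ u : F, ∑ v : F, (A u * A' v) * ψ (a * (v - u)) := by
          refine Finset.sum_congr rfl fun a _ => ?_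
          rw [show (4 : ℕ) = 2 + 2 from rfl, pow_add]
          nth_rewrite 1 [hP a]
          rw [hP' a, Finset.sum_mul_sum]
          refine Finset.sum_congr rfl fun u _ => Finset.sum_congr rfl fun v _ => ?_
          rw [show a * (v - u) = -(a * u) + a * v by ring, AddChar.map_add_eq_mul]
          ring
      _ = ∑ u : F, ∑ v : F, (A u * A' v) * ∑ a : F, ψ (a * (v - u)) := by
          rw [Finset.sum_comm]
          refine Finset.sum_congr rfl fun u _ => ?_
          rw [Finset.sum_comm]
          simp_rw [Finset.mul_sum]
      _ = _ := by
          rw [Finset.mul_sum]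
          refine Finset.sum_congr rfl fun u _ => ?_
          simp_rw [AddChar.sum_mulShift _ hψ, sub_eq_zero]
          simp [mul_comm]
  have h2 : ∀ u : F, A u * A' u = ∑ p : F × F, ψ (u ^ d *
      (((p.1 + 1) ^ d - p.1 ^ d) - ((p.2 + 1) ^ d - p.2 ^ d))) := by
    intro u
    have hd0 : d ≠ 0 := by rintro rfl; simp at hd
    rw [Fintype.sum_prod_type, hA, hA', Finset.sum_mul_sum]
    by_cases hu : u = 0
    · subst hu
      simp [zero_pow hd0]
    · refine (Fintype.sum_equiv (Equiv.mulLeft₀ u hu) _ _ fun x => ?_).symm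
      refine Fintype.sum_equiv (Equiv.mulLeft₀ u hu) _ _ fun y => ?_
      simp only [Equiv.mulLeft₀_apply, ← AddChar.map_add_eq_mul]
      congr 1
      rw [show u * x + u = u * (x + 1) by ring, show u * y + u = u * (y + 1) by ring]
      simp only [mul_pow]
      ring
  rw [h1, sq, mul_assoc]
  congr 1
  simp_rw [h2]
  rw [Finset.sum_comm]
  have h3 : ∀ c : F, ∑ u : F, ψ (u ^ d * c) = if c = 0 then (Fintype.card F : ℂ) else 0 := by
    intro c
    have := AddChar.sum_mulShift c hψ
    push_cast at this
    rw [← this]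
    exact Fintype.sum_equiv (Equiv.ofBijective _ hb) _ _ fun x => by simp
  simp_rw [h3]
  rw [← Finset.sum_filter, Finset.sum_const, nsmul_eq_mul, mul_comm]

theorem stmt_9 (F : Type*) [Field F] [Fintype F] [DecidableEq F] [Algebra (ZMod 3) F]
    (n r : ℕ) (hn : Odd n) (hcard : Fintype.card F = 3 ^ n)
    (d : ℕ) (hdef : d = 3 ^ r + 2)
    (hgcd : Nat.gcd d (3 ^ n - 1) = 1) (hrn : Nat.gcd r n = 1) :
    ∑ a ∈ Finset.univ.filter (fun a : F => a ≠ 0),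
        (∑ x : F, canonicalPsi 3 F (x ^ d - a * x)) ^ 4 = 3 * ((3 : ℂ) ^ n) ^ 3 := by
  obtain ⟨ψ, hψ, hψe⟩ := aux_char_s9 F
  simp_rw [hψe]
  have : CharP F 3 := charP_of_injective_algebraMap (algebraMap (ZMod 3) F).injective 3
  have hodd : Odd d := by
    rw [hdef]
    exact (Odd.pow (by decide)).add_even (by decide)
  have hb := aux_pow_bij F d hodd.pos.ne' (by rw [hcard]; exact hgcd)
  have hm := aux_moment F ψ hψ d hodd hb
  have h0 : ∑ x : F, ψ (x ^ d - 0 * x) = 0 := by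
    have h := AddChar.sum_mulShift (1 : F) hψ
    simp only [mul_one, one_ne_zero, if_false, Nat.cast_zero] at h
    rw [← h]
    exact Fintype.sum_equiv (Equiv.ofBijective _ hb) _ _ fun x => by simp
  have hs : ∑ a ∈ Finset.univ.filter (fun a : F => a ≠ 0), (∑ x : F, ψ (x ^ d - a * x)) ^ 4
      = ∑ a : F, (∑ x : F, ψ (x ^ d - a * x)) ^ 4 := by
    apply Finset.sum_filter_of_ne
    rintro a - h rfl
    exact h (by rw [h0]; simp)
  have hc := aux_count3 F n r hn hcard hrn
  rw [← hdef] at hc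
  rw [hs, hm, hc, hcard]
  push_cast
  ring
end

section
/- Let n be odd and d = 3^r + 2 with 4r ≡ 1 (mod n). For every nonzero x ∈ ℤ/(3^n − 1)ℤ, w(x) + w(−d·x) ≥ n + 1, where w denotes the ternary digit-sum on ℤ/(3^n − 1)ℤ. -/
/-- Potential function (packed base-4 table) on the states of the carry automaton. -/
def potTable : ℕ := 52588249917786586090750612158091109836584281302844453792111174840355412374530509257966484581219950067633765050560961443587762279487480759346859

def pot (c0 c1 c2 c3 a : ℕ) : ℕ :=
  (potTable / 4 ^ ((((((c0 - 1) * 3 + (c1 - 1)) * 3 + (c2 - 1)) * 3 + (c3 - 1)) * 3 + a))) % 4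

theorem pot_fin : ∀ c0 c1 c2 c3 c4 a0 a1 : Fin 3,
    2 * a0.val + a1.val + (c4.val + 1) ≤ 3 * (c0.val + 1) →
    3 * (c0.val + 1) ≤ 2 * a0.val + a1.val + (c4.val + 1) + 2 →
    2 * a0.val + 1 + pot (c0.val + 1) (c1.val + 1) (c2.val + 1) (c3.val + 1) a0.val ≤
      2 * (c0.val + 1) + pot (c1.val + 1) (c2.val + 1) (c3.val + 1) (c4.val + 1) a1.val := by
  decide +kernel

theorem pot_step (c0 c1 c2 c3 c4 a0 a1 b : ℕ)
    (h0 : 1 ≤ c0 ∧ c0 ≤ 3) (h1 : 1 ≤ c1 ∧ c1 ≤ 3) (h2 : 1 ≤ c2 ∧ c2 ≤ 3)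
    (h3 : 1 ≤ c3 ∧ c3 ≤ 3) (h4 : 1 ≤ c4 ∧ c4 ≤ 3) (ha0 : a0 < 3) (ha1 : a1 < 3) (hb : b < 3)
    (h : 3 * c0 = b + 2 * a0 + a1 + c4) :
    2 * a0 + 1 + pot c0 c1 c2 c3 a0 ≤ 2 * c0 + pot c1 c2 c3 c4 a1 := by
  have := pot_fin ⟨c0 - 1, by omega⟩ ⟨c1 - 1, by omega⟩ ⟨c2 - 1, by omega⟩ ⟨c3 - 1, by omega⟩
    ⟨c4 - 1, by omega⟩ ⟨a0, ha0⟩ ⟨a1, ha1⟩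
  simp only [Nat.sub_add_cancel h0.1, Nat.sub_add_cancel h1.1, Nat.sub_add_cancel h2.1,
    Nat.sub_add_cancel h3.1, Nat.sub_add_cancel h4.1] at this
  exact this (by omega) (by omega)

/-- Leading ternary digit of the periodic expansion of `z / M`. -/
def dg {M : ℕ} (z : ZMod M) : ℕ := 3 * z.val / M

theorem dg_spec {M : ℕ} [NeZero M] (z : ZMod M) :
    3 * z.val = dg z * M + (3 * z).val := by
  have h : (3 * z).val = (3 * z.val) % M := by
    rw [← ZMod.val_natCast]
    congr 1
    push_cast
    rw [ZMod.natCast_zmod_val]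
  rw [h, dg, mul_comm _ M]
  exact (Nat.div_add_mod _ _).symm

theorem dg_lt {M : ℕ} [NeZero M] (z : ZMod M) : dg z < 3 := by
  have hM : 0 < M := Nat.pos_of_ne_zero (NeZero.ne M)
  rw [dg, Nat.div_lt_iff_lt_mul hM]
  have := ZMod.val_lt z
  omega

theorem digits_sum_step (f a : ℕ) (ha : a < 3) :
    (Nat.digits 3 (a + 3 * f)).sum = a + (Nat.digits 3 f).sum := by
  by_cases h : a ≠ 0 ∨ f ≠ 0
  · rw [Nat.digits_add 3 (by norm_num) a f ha h]
    simp
  · push Not at h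
    simp [h.1, h.2]

theorem exists_prefix {M : ℕ} [NeZero M] (z : ZMod M) (k : ℕ) :
    ∃ F : ℕ, 3 ^ k * z.val = F * M + (3 ^ k * z).val ∧
      (Nat.digits 3 F).sum = ∑ i ∈ Finset.range k, dg (3 ^ i * z) := by
  induction k with
  | zero => exact ⟨0, by simp, by simp⟩
  | succ k ih =>
    obtain ⟨F, h1, h2⟩ := ih
    refine ⟨dg (3 ^ k * z) + 3 * F, ?_, ?_⟩
    · have h := dg_spec (3 ^ k * z)
      have e : (3 : ZMod M) ^ (k + 1) * z = 3 * (3 ^ k * z) := by ring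
      rw [e]
      calc 3 ^ (k + 1) * z.val = 3 * (3 ^ k * z.val) := by ring
        _ = 3 * F * M + 3 * (3 ^ k * z).val := by rw [h1]; ring
        _ = _ := by rw [h]; ring
    · rw [digits_sum_step _ _ (dg_lt _), h2, Finset.sum_range_succ, add_comm]

theorem three_pow_n (n : ℕ) : (3 : ZMod (3 ^ n - 1)) ^ n = 1 := by
  have h : ((3 ^ n - 1 : ℕ) : ZMod (3 ^ n - 1)) = 0 := ZMod.natCast_self _
  rw [Nat.cast_sub (Nat.one_le_pow _ _ (by norm_num))] at h
  push_cast at h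
  exact sub_eq_zero.mp h

theorem digits_sum_eq (n : ℕ) [NeZero (3 ^ n - 1)] (z : ZMod (3 ^ n - 1)) :
    (Nat.digits 3 z.val).sum = ∑ i ∈ Finset.range n, dg (3 ^ i * z) := by
  obtain ⟨F, h1, h2⟩ := exists_prefix z n
  rw [three_pow_n, one_mul] at h1
  have h3 : 0 < 3 ^ n - 1 := Nat.pos_of_ne_zero (NeZero.ne _)
  have h4 : (3 ^ n - 1) * z.val = (3 ^ n - 1) * F := by
    rw [Nat.sub_mul, h1, one_mul, Nat.add_sub_cancel, mul_comm]
  rw [Nat.eq_of_mul_eq_mul_left h3 h4, h2]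

theorem sum_shift (n : ℕ) (f : ℕ → ℕ) (hf : ∀ i, f (i + n) = f i) (r : ℕ) :
    ∑ i ∈ Finset.range n, f (i + r) = ∑ i ∈ Finset.range n, f i := by
  induction r with
  | zero => simp
  | succ r ih =>
    rw [← ih]
    have h1 := Finset.sum_range_succ (fun i => f (i + r)) n
    have h2 := Finset.sum_range_succ' (fun i => f (i + r)) n
    have h3 : f (n + r) = f (0 + r) := by rw [add_comm n r, hf, zero_add]
    have h4 : ∀ i, f (i + 1 + r) = f (i + (r + 1)) := fun i => by congr 1; ring
    simp only [h4] at h2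
    omega

theorem stmt_14 (n r : ℕ) (hn : Odd n) (h4r : 4 * r ≡ 1 [MOD n])
    (d : ZMod (3 ^ n - 1)) (hd : d = (3 : ZMod (3 ^ n - 1)) ^ r + 2) :
    ∀ x : ZMod (3 ^ n - 1), x ≠ 0 →
      (Nat.digits 3 x.val).sum + (Nat.digits 3 (-(d * x)).val).sum ≥ n + 1 := by
  intro x hx
  have hn0 : 0 < n := hn.pos
  have hM : 0 < 3 ^ n - 1 := by
    have := Nat.one_lt_pow hn0.ne' (show 1 < 3 by norm_num)
    omega
  have : NeZero (3 ^ n - 1) := ⟨hM.ne'⟩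
  have hp := three_pow_n n
  set y := -(d * x) with hy
  rw [digits_sum_eq n x, digits_sum_eq n y]
  have hper : ∀ (i : ℕ), (3 : ZMod (3 ^ n - 1)) ^ (i + n) = 3 ^ i := fun i => by
    rw [pow_add, hp, mul_one]
  have hmod : ∀ i : ℕ, (3 : ZMod (3 ^ n - 1)) ^ i = 3 ^ (i % n) := fun i => by
    conv_lhs => rw [← Nat.mod_add_div i n, pow_add, pow_mul, hp, one_pow, mul_one]
  have h4 : (3 : ZMod (3 ^ n - 1)) ^ (4 * r) = 3 := by
    rw [hmod, h4r, ← hmod, pow_one]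
  have hunit : ∀ i : ℕ, (3 : ZMod (3 ^ n - 1)) ^ i * x ≠ 0 := by
    intro i h
    have hu : IsUnit ((3 : ZMod (3 ^ n - 1)) ^ i) :=
      (IsUnit.of_pow_eq_one hp hn0.ne').pow i
    exact hx ((hu.mul_right_eq_zero).mp h)
  have hlin : ∀ i : ℕ, ∃ m : ℕ, (3 ^ i * y).val + 2 * (3 ^ i * x).val + (3 ^ (i + r) * x).val
      = m * (3 ^ n - 1) := by
    intro i
    have : (((3 ^ i * y).val + 2 * (3 ^ i * x).val + (3 ^ (i + r) * x).val : ℕ) :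
        ZMod (3 ^ n - 1)) = 0 := by
      push_cast
      simp only [ZMod.natCast_zmod_val]
      rw [hy, hd]
      ring
    rw [ZMod.natCast_eq_zero_iff] at this
    obtain ⟨m, hm⟩ := this
    exact ⟨m, by rw [hm, mul_comm]⟩
  choose m hm using hlin
  have hm1 : ∀ i, 1 ≤ m i ∧ m i ≤ 3 := by
    intro i
    have h1 : 0 < (3 ^ i * x).val := Nat.pos_of_ne_zero fun h =>
      hunit i ((ZMod.val_eq_zero _).mp h)
    have e1 := ZMod.val_lt (3 ^ i * x)
    have e2 := ZMod.val_lt (3 ^ i * y)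
    have e3 := ZMod.val_lt (3 ^ (i + r) * x)
    have h := hm i
    constructor
    · by_contra hc
      have : m i = 0 := by omega
      rw [this, zero_mul] at h
      omega
    · by_contra hc
      have : 4 * (3 ^ n - 1) ≤ m i * (3 ^ n - 1) := Nat.mul_le_mul_right _ (by omega)
      omega
  have hrec : ∀ i, 3 * m i = dg (3 ^ i * y) + 2 * dg (3 ^ i * x) + dg (3 ^ (i + r) * x)
      + m (i + 1) := by
    intro i
    apply Nat.eq_of_mul_eq_mul_right hM
    have s1 := dg_spec (3 ^ i * y)
    have s2 := dg_spec (3 ^ i * x)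
    have s3 := dg_spec (3 ^ (i + r) * x)
    have t1 : (3 : ZMod (3 ^ n - 1)) * (3 ^ i * y) = 3 ^ (i + 1) * y := by ring
    have t2 : (3 : ZMod (3 ^ n - 1)) * (3 ^ i * x) = 3 ^ (i + 1) * x := by ring
    have t3 : (3 : ZMod (3 ^ n - 1)) * (3 ^ (i + r) * x) = 3 ^ (i + 1 + r) * x := by ring
    rw [t1] at s1
    rw [t2] at s2
    rw [t3] at s3
    have h0 := hm i
    have h1 := hm (i + 1)
    linarith
  have hmcongr : ∀ i j : ℕ, (3 : ZMod (3 ^ n - 1)) ^ i = 3 ^ j → m i = m j := by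
    intro i j h
    apply Nat.eq_of_mul_eq_mul_right hM
    rw [← hm i, ← hm j, pow_add, pow_add, h]
  have hm4 : ∀ i, m (i + 1) = m (i + 4 * r) := fun i => hmcongr _ _ (by
    rw [pow_add, pow_add, h4, pow_one])
  have hmn : ∀ i, m (i + n) = m i := fun i => hmcongr _ _ (hper i)
  have han : ∀ i, dg ((3 : ZMod (3 ^ n - 1)) ^ (i + n) * x) = dg (3 ^ i * x) := fun i => by
    rw [hper]
  let P : ℕ → ℕ := fun i => pot (m i) (m (i + r)) (m (i + 2 * r)) (m (i + 3 * r)) (dg (3 ^ i * x))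
  have hPn : ∀ i, P (i + n) = P i := by
    intro i
    have e : ∀ k, m (i + n + k) = m (i + k) := fun k => by
      rw [add_right_comm, hmn]
    simp only [P, e, hmn, han]
  have hstep : ∀ i, 2 * dg (3 ^ i * x) + 1 + P i ≤ 2 * m i + P (i + r) := by
    intro i
    have h := hrec i
    rw [hm4] at h
    have := pot_step _ (m (i + r)) (m (i + 2 * r)) (m (i + 3 * r)) _ _ _ _ (hm1 _) (hm1 _)
      (hm1 _) (hm1 _) (hm1 _) (dg_lt _) (dg_lt _) (dg_lt _) h
    have q1 : i + r + r = i + 2 * r := by ring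
    have q2 : i + r + 2 * r = i + 3 * r := by ring
    have q3 : i + r + 3 * r = i + 4 * r := by ring
    simp only [P, q1, q2, q3]
    exact this
  have S1 := Finset.sum_le_sum (s := Finset.range n) fun i _ => hstep i
  have S2 := Finset.sum_congr (rfl : Finset.range n = Finset.range n) fun i _ => hrec i
  simp only [Finset.sum_add_distrib, ← Finset.mul_sum, Finset.sum_const, Finset.card_range,
    smul_eq_mul, mul_one] at S1 S2
  rw [sum_shift n P hPn r] at S1
  rw [sum_shift n m hmn 1, sum_shift n (fun i => dg (3 ^ i * x)) han r] at S2
  obtain ⟨k, hk⟩ := hn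
  omega
end
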